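/- arXiv:1509.08491 — 4 statements merged into one kernel-verified Lean document; each statement's English description precedes it below -/
import Mathlib

section
/- Fix integers n ≥ 1 and L ≥ 1. For j = 1,…,n let (Λ_j, q_j) be a measurable space equipped with a probability measure, and suppose that for each j ∈ {1,…,n}, k ∈ {1,…,L} and each setting x ∈ {0,1} there is a measurable function A_{j,k}^{x} : Λ_j → [−1,1], and for each subset X ⊆ {1,…,L} there is a measurable function B_X : Λ_1 × ⋯ × Λ_n → [−1,1]. For each X ⊆ {1,…,L} define K_X = (1/2^{nL}) ∑_{x̄} [∏_{j=1}^{n} (−1)^{∑_{k∈X} x_j^k}] ∫ (∏_{j=1}^{n} ∏_{k=1}^{L} A_{j,k}^{x_j^k}(λ_j)) · B_X(λ_1,…,λ_n) dq_1(λ_1)⋯dq_n(λ_n), where the sum runs over all tuples x̄ = (x_j^k)_{j,k} ∈ {0,1}^{nL}. Then ∑_{X ⊆ {1,…,L}} |K_X|^{1/n} ≤ 1. -/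
open MeasureTheory

/-- The signed average over the settings `x` of the product of the outcomes `a k (x k)`, in
factorised form: the observers in `X` contribute `(a k 0 - a k 1) / 2`, the others
`(a k 0 + a k 1) / 2`. -/
noncomputable def signedAverage {κ : Type*} [Fintype κ] [DecidableEq κ]
    (X : Finset κ) (a : κ → Fin 2 → ℝ) : ℝ :=
  ∏ k, ∑ x : Fin 2, (if k ∈ X then (-1 : ℝ) ^ (x : ℕ) else 1) * a k x / 2

theorem signedAverage_eq_sum {κ : Type*} [Fintype κ] [DecidableEq κ]
    (X : Finset κ) (a : κ → Fin 2 → ℝ) :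
    signedAverage X a = ∑ x : κ → Fin 2,
      (-1 : ℝ) ^ (∑ k ∈ X, (x k : ℕ)) * (∏ k, a k (x k)) / 2 ^ Fintype.card κ := by
  rw [signedAverage, Finset.prod_univ_sum, Fintype.piFinset_univ]
  refine Finset.sum_congr rfl fun x _ => ?_
  rw [Finset.prod_div_distrib, Finset.prod_mul_distrib, Finset.prod_const, Finset.card_univ,
    Finset.prod_ite_mem, Finset.univ_inter, Finset.prod_pow_eq_pow_sum]

theorem prod_signedAverage_eq_sum {ι κ : Type*} [Fintype ι] [DecidableEq ι] [Fintype κ]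
    [DecidableEq κ] (X : Finset κ) (a : ι → κ → Fin 2 → ℝ) :
    ∏ j, signedAverage X (a j) = (1 / 2 ^ (Fintype.card ι * Fintype.card κ)) *
      ∑ x : ι → κ → Fin 2, (∏ j, (-1 : ℝ) ^ (∑ k ∈ X, (x j k : ℕ))) *
        ∏ j, ∏ k, a j k (x j k) := by
  simp_rw [signedAverage_eq_sum]
  rw [Finset.prod_univ_sum, Fintype.piFinset_univ, Finset.mul_sum]
  refine Finset.sum_congr rfl fun x _ => ?_
  rw [Finset.prod_div_distrib, Finset.prod_mul_distrib, Finset.prod_const, Finset.card_univ,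
    ← pow_mul, mul_comm (Fintype.card κ)]
  ring

theorem sum_abs_signedAverage_le_one {κ : Type*} [Fintype κ] [DecidableEq κ]
    (a : κ → Fin 2 → ℝ) (ha : ∀ k x, a k x ∈ Set.Icc (-1 : ℝ) 1) :
    ∑ X : Finset κ, |signedAverage X a| ≤ 1 := by
  have h : ∑ X : Finset κ, |signedAverage X a| =
      ∏ k, (|(a k 0 - a k 1) / 2| + |(a k 0 + a k 1) / 2|) := by
    rw [Finset.prod_add, Finset.powerset_univ]
    refine Finset.sum_congr rfl fun X _ => ?_
    rw [signedAverage, Finset.abs_prod, ← Finset.prod_mul_prod_compl X,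
      ← Finset.compl_eq_univ_sdiff]
    congr 1 <;> refine Finset.prod_congr rfl fun k hk => ?_
    · simp only [Fin.sum_univ_two, hk, if_true]
      congr 1
      simp
      ring
    · simp only [Fin.sum_univ_two, Finset.mem_compl.1 hk, if_false]
      congr 1
      ring
  rw [h]
  refine Finset.prod_le_one (fun k _ => by positivity) fun k _ => ?_
  obtain ⟨h0, h0'⟩ := ha k 0
  obtain ⟨h1, h1'⟩ := ha k 1
  rcases abs_cases ((a k 0 - a k 1) / 2) with h | h <;>
    rcases abs_cases ((a k 0 + a k 1) / 2) with h' | h' <;> linarith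

theorem measurable_signedAverage {κ Ω : Type*} [Fintype κ] [DecidableEq κ] [MeasurableSpace Ω]
    (X : Finset κ) (A : κ → Fin 2 → Ω → ℝ) (hA : ∀ k x, Measurable (A k x)) :
    Measurable fun l => signedAverage X fun k x => A k x l := by
  unfold signedAverage
  fun_prop

theorem abs_signedAverage_le_one {κ : Type*} [Fintype κ] [DecidableEq κ] (X : Finset κ)
    (a : κ → Fin 2 → ℝ) (ha : ∀ k x, a k x ∈ Set.Icc (-1 : ℝ) 1) : |signedAverage X a| ≤ 1 :=
  (Finset.single_le_sum (f := fun X => |signedAverage X a|) (fun _ _ => abs_nonneg _)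
    (Finset.mem_univ X)).trans (sum_abs_signedAverage_le_one a ha)

/-- A bounded weight does not increase the integral of a product beyond the product of the
integrals of the absolute values. -/
theorem abs_integral_prod_mul_le {ι : Type*} [Fintype ι] {Λ : ι → Type*}
    [∀ j, MeasurableSpace (Λ j)] (μ : ∀ j, Measure (Λ j)) [∀ j, SigmaFinite (μ j)]
    (f : ∀ j, Λ j → ℝ) (hf : ∀ j, Integrable (f j) (μ j)) (b : (∀ j, Λ j) → ℝ)
    (hb : ∀ l, |b l| ≤ 1) :
    |∫ l, (∏ j, f j (l j)) * b l ∂Measure.pi μ| ≤ ∏ j, ∫ l, |f j l| ∂μ j := by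
  rw [← integral_fintype_prod_eq_prod, ← Real.norm_eq_abs]
  refine norm_integral_le_of_norm_le (Integrable.fintype_prod_dep fun j => (hf j).abs)
    (Filter.Eventually.of_forall fun l => ?_)
  rw [Real.norm_eq_abs, abs_mul, Finset.abs_prod]
  exact mul_le_of_le_one_right (Finset.prod_nonneg fun _ _ => abs_nonneg _) (hb l)

theorem sum_prod_rpow_inv_card_le_one {ι κ : Type*} [Fintype ι] [Nonempty ι] [Fintype κ]
    (E : ι → κ → ℝ) (hE : ∀ j X, 0 ≤ E j X) (hsum : ∀ j, ∑ X, E j X ≤ 1) :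
    ∑ X, (∏ j, E j X) ^ ((1 : ℝ) / Fintype.card ι) ≤ 1 := by
  have hn : (Fintype.card ι : ℝ) ≠ 0 := by simp
  calc ∑ X, (∏ j, E j X) ^ ((1 : ℝ) / Fintype.card ι)
      ≤ ∑ X, ∑ j, (1 : ℝ) / Fintype.card ι * E j X := by
        refine Finset.sum_le_sum fun X _ => ?_
        rw [← Real.finsetProd_rpow _ _ fun j _ => hE j X]
        refine Real.geom_mean_le_arith_mean_weighted _ _ _ (fun _ _ => by positivity) ?_
          fun j _ => hE j X
        simp [hn]
    _ = ∑ j, (1 : ℝ) / Fintype.card ι * ∑ X, E j X := by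
        rw [Finset.sum_comm]
        simp_rw [Finset.mul_sum]
    _ ≤ ∑ _j : ι, (1 : ℝ) / Fintype.card ι * 1 := by
        gcongr with j
        exact hsum j
    _ = 1 := by simp [hn]

/-- **Bell-type inequality for the network `𝒩_n^L` (Theorem 1 of the paper).**
There are `n` independent sources; source `j` emits a hidden variable `λ_j ∈ Λ_j`
distributed according to the probability measure `μ j`.  For each source `j`, each of
the `L` attached observers `k` has two settings `x ∈ {0,1}` with local outcome
expectation `A j k x (λ_j) ∈ [-1,1]`, and the central observer Bob has, for each subset
`X ⊆ {1,…,L}`, an outcome expectation `B X (λ̄) ∈ [-1,1]`.  With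
`K X = 2^{-nL} ∑_{x̄} (∏_j (-1)^{∑_{k∈X} x_j^k}) ∫ (∏_{j,k} A j k (x_j^k) λ_j) B X λ̄ dμ`,
every such classical model satisfies `∑_X |K X|^{1/n} ≤ 1`. -/
theorem bell_inequality_connected_network
    (n L : ℕ) (hn : 1 ≤ n) (hL : 1 ≤ L)
    (Λ : Fin n → Type) [∀ j, MeasurableSpace (Λ j)]
    (μ : ∀ j, Measure (Λ j)) [∀ j, IsProbabilityMeasure (μ j)]
    (A : (j : Fin n) → Fin L → Fin 2 → Λ j → ℝ)
    (hAmeas : ∀ j k x, Measurable (A j k x))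
    (hAbd : ∀ j k x lam, A j k x lam ∈ Set.Icc (-1 : ℝ) 1)
    (B : Finset (Fin L) → (∀ j, Λ j) → ℝ)
    (hBmeas : ∀ X, Measurable (B X))
    (hBbd : ∀ X lam, B X lam ∈ Set.Icc (-1 : ℝ) 1)
    (K : Finset (Fin L) → ℝ)
    (hK : ∀ X : Finset (Fin L), K X =
      (1 / 2 ^ (n * L)) * ∑ x : Fin n → Fin L → Fin 2,
        (∏ j : Fin n, (-1 : ℝ) ^ (∑ k ∈ X, (x j k : ℕ))) *
          ∫ lam, (∏ j : Fin n, ∏ k : Fin L, A j k (x j k) (lam j)) * B X lam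
            ∂(Measure.pi μ)) :
    ∑ X : Finset (Fin L), |K X| ^ ((1 : ℝ) / n) ≤ 1 := by
  have : Nonempty (Fin n) := ⟨⟨0, hn⟩⟩
  set C : (j : Fin n) → Finset (Fin L) → Λ j → ℝ :=
    fun j X l => signedAverage X fun k x => A j k x l with hC
  have hCint : ∀ j X, Integrable (C j X) (μ j) := fun j X =>
    Integrable.of_bound (measurable_signedAverage X _ (hAmeas j)).aestronglyMeasurable 1
      (Filter.Eventually.of_forall fun l => abs_signedAverage_le_one X _ fun k x => hAbd j k x l)
  have hKeq : ∀ X, K X = ∫ l, (∏ j, C j X (l j)) * B X l ∂Measure.pi μ := by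
    intro X
    have hint : ∀ x : Fin n → Fin L → Fin 2, Integrable
        (fun l => (∏ j, ∏ k, A j k (x j k) (l j)) * B X l) (Measure.pi μ) := by
      intro x
      refine Integrable.of_bound (C := 1) (Measurable.aestronglyMeasurable ?_)
        (Filter.Eventually.of_forall fun l => ?_)
      · have := hBmeas X
        fun_prop
      · rw [Real.norm_eq_abs, abs_mul, Finset.abs_prod]
        refine mul_le_one₀ (Finset.prod_le_one (fun _ _ => abs_nonneg _) fun j _ => ?_)
          (abs_nonneg _) (abs_le.2 (hBbd X l))
        rw [Finset.abs_prod]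
        exact Finset.prod_le_one (fun _ _ => abs_nonneg _) fun k _ => abs_le.2 (hAbd ..)
    simp_rw [hK X, ← integral_const_mul]
    rw [← integral_finsetSum _ fun x _ => (hint x).const_mul _, ← integral_const_mul]
    refine integral_congr_ae (Filter.Eventually.of_forall fun l => ?_)
    simp only [hC]
    rw [prod_signedAverage_eq_sum X fun j k x => A j k x (l j), Fintype.card_fin,
      Fintype.card_fin, mul_assoc, Finset.sum_mul]
    simp_rw [mul_assoc]
  have hbound : ∀ X, |K X| ≤ ∏ j, ∫ l, |C j X l| ∂μ j := fun X => by
    rw [hKeq X]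
    exact abs_integral_prod_mul_le μ _ (fun j => hCint j X) _ fun l => abs_le.2 (hBbd X l)
  have hsum : ∀ j, ∑ X, ∫ l, |C j X l| ∂μ j ≤ 1 := by
    intro j
    rw [← integral_finsetSum _ fun X _ => (hCint j X).abs]
    calc ∫ l, ∑ X, |C j X l| ∂μ j ≤ ∫ _, (1 : ℝ) ∂μ j :=
          integral_mono (integrable_finsetSum _ fun X _ => (hCint j X).abs)
            (integrable_const _)
            fun l => sum_abs_signedAverage_le_one _ fun k x => hAbd j k x l
      _ = 1 := by simp
  calc ∑ X, |K X| ^ ((1 : ℝ) / n)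
      ≤ ∑ X, (∏ j, ∫ l, |C j X l| ∂μ j) ^ ((1 : ℝ) / n) := by
        gcongr with X
        exact hbound X
    _ ≤ 1 := by
        simpa using sum_prod_rpow_inv_card_le_one (fun j X => ∫ l, |C j X l| ∂μ j)
          (fun j X => integral_nonneg fun l => abs_nonneg _) hsum
end

section
/- Fix integers n ≥ 1 and L ≥ 1 and numbers p_j^k ∈ [0,1] for j = 1,…,n, k = 1,…,L. Consider the classical strategy D in which, for each j, a bit λ_j ∈ {0,1} is drawn uniformly at random, independent bits α_j^k ∈ {0,1} are drawn with P(α_j^k = 0) = p_j^k, the outcome of observer (j,k) under setting x_j^k ∈ {0,1} is a_j^k = λ_j ⊕ α_j^k x_j^k, and Bob's outcome is b = λ_1 ⊕ ⋯ ⊕ λ_n if L is odd and b = 0 if L is even. Then for every subset X ⊆ {1,…,L}, the quantity K_X = (1/2^{nL}) ∑_{x̄ ∈ {0,1}^{nL}} [∏_{j=1}^{n} (−1)^{∑_{k∈X} x_j^k}] · E[(−1)^{b + ∑_{j,k} a_j^k}] equals ∏_{j=1}^{n} ( ∏_{k∈X} (1 − p_j^k) · ∏_{k∉X} p_j^k ).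 -/
theorem sum_pi_pi_prod_prod {ι κ β R : Type*} [Fintype ι] [Fintype κ] [Fintype β]
    [DecidableEq ι] [DecidableEq κ] [CommSemiring R] (f : ι → κ → β → R) :
    ∑ x : ι → κ → β, ∏ j, ∏ k, f j k (x j k) = ∏ j, ∏ k, ∑ b, f j k b := by
  simp_rw [Fintype.prod_sum]

theorem sign_xor (a b : Bool) :
    (if xor a b then (-1 : ℝ) else 1) = (if a then -1 else 1) * (if b then -1 else 1) := by
  cases a <;> cases b <;> simp

/-- Bob's sign cancels the signs `(-1) ^ (L * λ_j)` picked up by the other observers. -/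
theorem bob_sign_mul_prod_sign (n L : ℕ) (lam : Fin n → Bool) (c : Fin n → Fin L → Bool) :
    (if L % 2 = 1 then ∏ j : Fin n, (if lam j then (-1 : ℝ) else 1) else 1) *
        ∏ j : Fin n, ∏ k : Fin L, (if xor (lam j) (c j k) then (-1 : ℝ) else 1) =
      ∏ j : Fin n, ∏ k : Fin L, (if c j k then (-1 : ℝ) else 1) := by
  simp_rw [sign_xor, Finset.prod_mul_distrib]
  rw [← mul_assoc]
  convert one_mul _
  split_ifs with h
  · rw [← Finset.prod_mul_distrib]
    refine Finset.prod_eq_one fun j _ => ?_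
    have h' : Odd L := Nat.odd_iff.mpr h
    cases lam j <;> simp [h'.neg_one_pow]
  · have h' : Even L := by rwa [← Nat.not_odd_iff_even, Nat.odd_iff]
    rw [one_mul]
    refine Finset.prod_eq_one fun j _ => ?_
    cases lam j <;> simp [h'.neg_one_pow]

/-- **Value of the correlators `K_X` for the classical strategy `D` (Theorem 2 of the paper).**
In strategy `D`, each `λ_j ∈ {0,1}` is uniform, each `α_j^k ∈ {0,1}` has
`P(α_j^k = 0) = p_j^k`, observer `(j,k)` outputs `a_j^k = λ_j ⊕ α_j^k x_j^k`, and Bob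
outputs `b = λ_1 ⊕ ⋯ ⊕ λ_n` if `L` is odd and `b = 0` if `L` is even.  Then for every
`X ⊆ {1,…,L}`, the correlator
`K_X = 2^{-nL} ∑_{x̄} (∏_j (-1)^{∑_{k∈X} x_j^k}) E[(-1)^{b + ∑_{j,k} a_j^k}]`
equals `∏_j (∏_{k∈X}(1-p_j^k) ∏_{k∉X} p_j^k)`.  Here the expectation is written as the
finite weighted sum over the bits `λ_j` (weight `2^{-n}` in total) and `α_j^k`
(weight `p_j^k` for `α_j^k = 0` and `1 - p_j^k` for `α_j^k = 1`), and
`(-1)^{b + ∑ a_j^k}` is expanded as a product of signs. -/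
theorem classical_strategy_correlator_value
    (n L : ℕ) (hn : 1 ≤ n) (hL : 1 ≤ L)
    (p : Fin n → Fin L → ℝ) (hp : ∀ j k, p j k ∈ Set.Icc (0 : ℝ) 1)
    (X : Finset (Fin L)) :
    (1 / 2 ^ (n * L)) *
      ∑ x : Fin n → Fin L → Bool,
        (∏ j : Fin n, ∏ k ∈ X, (if x j k then (-1 : ℝ) else 1)) *
          ∑ lam : Fin n → Bool, ∑ α : Fin n → Fin L → Bool,
            (1 / 2 ^ n) *
              (∏ j : Fin n, ∏ k : Fin L, (if α j k then 1 - p j k else p j k)) *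
              ((if L % 2 = 1 then ∏ j : Fin n, (if lam j then (-1 : ℝ) else 1) else 1) *
                ∏ j : Fin n, ∏ k : Fin L,
                  (if xor (lam j) (α j k && x j k) then (-1 : ℝ) else 1))
      = ∏ j : Fin n, ((∏ k ∈ X, (1 - p j k)) * ∏ k ∈ Xᶜ, p j k) := by
  simp_rw [bob_sign_mul_prod_sign]
  have hx : ∀ x : Fin n → Fin L → Bool,
      (∏ j : Fin n, ∏ k ∈ X, (if x j k then (-1 : ℝ) else 1)) *
          ∑ _lam : Fin n → Bool, ∑ α : Fin n → Fin L → Bool,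
            (1 / 2 ^ n) *
              (∏ j : Fin n, ∏ k : Fin L, (if α j k then 1 - p j k else p j k)) *
              ∏ j : Fin n, ∏ k : Fin L, (if α j k && x j k then (-1 : ℝ) else 1) =
        ∏ j : Fin n, ∏ k : Fin L, (if k ∈ X then (if x j k then (-1 : ℝ) else 1) else 1) *
          ∑ a : Bool, (if a then 1 - p j k else p j k) *
            (if a && x j k then (-1 : ℝ) else 1) := by
    intro x
    simp_rw [mul_assoc, ← Finset.mul_sum, ← Finset.prod_mul_distrib]
    rw [sum_pi_pi_prod_prod fun j k a => (if a then 1 - p j k else p j k) *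
      (if a && x j k then (-1 : ℝ) else 1)]
    simp_rw [Finset.prod_mul_distrib, Finset.prod_ite_mem, Finset.univ_inter]
    congr 1
    simp
  simp_rw [hx]
  rw [sum_pi_pi_prod_prod fun j k b => (if k ∈ X then (if b then (-1 : ℝ) else 1) else 1) *
    ∑ a : Bool, (if a then 1 - p j k else p j k) * (if a && b then (-1 : ℝ) else 1)]
  have hs : ∀ j k, (∑ b : Bool, (if k ∈ X then (if b then (-1 : ℝ) else 1) else 1) *
      ∑ a : Bool, (if a then 1 - p j k else p j k) * (if a && b then (-1 : ℝ) else 1)) =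
      2 * if k ∈ X then 1 - p j k else p j k := by
    intro j k
    by_cases hk : k ∈ X <;> simp [hk] <;> ring
  have hX : ∀ j, (∏ k : Fin L, if k ∈ X then 1 - p j k else p j k) =
      (∏ k ∈ X, (1 - p j k)) * ∏ k ∈ Xᶜ, p j k := by
    intro j
    rw [← Finset.prod_mul_prod_compl X]
    congr 1
    · exact Finset.prod_congr rfl fun k hk => if_pos hk
    · exact Finset.prod_congr rfl fun k hk => if_neg (Finset.mem_compl.mp hk)
  simp_rw [hs, Finset.prod_mul_distrib (f := fun _ => (2 : ℝ)), hX, Finset.prod_const,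
    Finset.card_univ, Fintype.card_fin]
  rw [Finset.prod_mul_distrib, Finset.prod_const, Finset.card_univ, Fintype.card_fin,
    ← pow_mul, mul_comm L n, ← mul_assoc, one_div,
    inv_mul_cancel₀ (pow_ne_zero _ two_ne_zero), one_mul]
end

section
/- Let L ≥ 2 be even and let X ⊆ {1,…,L}. Define R(L) = 1 if L ≡ 0 (mod 4) and R(L) = 0 otherwise, and set y_X = (1 + (−1)^{|X| + R(L)})/2 ∈ {0,1}. Then | ∑_{x ∈ {0,1}^L} (−1)^{∑_{k∈X} x_k} cos((π/2)(x_1 + ⋯ + x_L + y_X)) | = 2^{L/2}. -/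
open Real

theorem Real.cos_pi_div_two_mul_natCast (n : ℕ) :
    Real.cos (π / 2 * n) = (Complex.I ^ n).re := by
  rw [← Complex.exp_pi_div_two_mul_I, ← Complex.exp_nat_mul,
    show (n : ℂ) * (π / 2 * Complex.I) = ((π / 2 * n : ℝ) : ℂ) * Complex.I by push_cast; ring,
    Complex.exp_ofReal_mul_I_re]

theorem sum_neg_one_pow_mul_I_pow {ι : Type*} [Fintype ι] [DecidableEq ι] (X : Finset ι) :
    ∑ x : ι → Fin 2, (-1 : ℂ) ^ (∑ k ∈ X, (x k : ℕ)) * Complex.I ^ (∑ k, (x k : ℕ)) =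
      (-Complex.I) ^ X.card * (1 + Complex.I) ^ Fintype.card ι := by
  have hterm (x : ι → Fin 2) :
      (-1 : ℂ) ^ (∑ k ∈ X, (x k : ℕ)) * Complex.I ^ (∑ k, (x k : ℕ)) =
        ∏ k, ((if k ∈ X then -1 else 1) * Complex.I) ^ (x k : ℕ) := by
    simp_rw [mul_pow, Finset.prod_mul_distrib, Finset.prod_pow_eq_pow_sum, ite_pow, one_pow,
      Finset.prod_ite_mem, Finset.univ_inter, Finset.prod_pow_eq_pow_sum]
  have hfactor (k : ι) :
      ∑ j : Fin 2, ((if k ∈ X then -1 else 1) * Complex.I) ^ (j : ℕ) =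
        (if k ∈ X then -Complex.I else 1) * (1 + Complex.I) := by
    rw [Fin.sum_univ_two]
    split_ifs
    · simp [mul_add]
      ring
    · simp
  simp_rw [hterm]
  rw [← Fintype.piFinset_univ, ← Finset.prod_univ_sum (fun _ : ι => Finset.univ)
    (fun k (j : Fin 2) => ((if k ∈ X then -1 else 1) * Complex.I) ^ (j : ℕ))]
  simp_rw [hfactor, Finset.prod_mul_distrib, Finset.prod_ite_mem, Finset.univ_inter,
    Finset.prod_const, Finset.card_univ]

theorem abs_sum_neg_one_pow_mul_cos {ι : Type*} [Fintype ι] [DecidableEq ι] (X : Finset ι)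
    {m y : ℕ} (hm : Fintype.card ι = m + m) (hy : Even (y + X.card + m)) :
    |∑ x : ι → Fin 2, (-1 : ℝ) ^ (∑ k ∈ X, (x k : ℕ)) *
      Real.cos (π / 2 * ((∑ k, (x k : ℕ) : ℕ) + y))| = 2 ^ m := by
  have hsum : ∑ x : ι → Fin 2, (-1 : ℝ) ^ (∑ k ∈ X, (x k : ℕ)) *
      Real.cos (π / 2 * ((∑ k, (x k : ℕ) : ℕ) + y)) =
      (Complex.I ^ y * ((-Complex.I) ^ X.card * (1 + Complex.I) ^ Fintype.card ι)).re := by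
    rw [← sum_neg_one_pow_mul_I_pow, Finset.mul_sum, Complex.re_sum]
    refine Finset.sum_congr rfl fun x _ => ?_
    rw [← Nat.cast_add, Real.cos_pi_div_two_mul_natCast, ← Complex.re_ofReal_mul]
    congr 1
    push_cast
    ring
  obtain ⟨r, hr⟩ := hy
  have hsq : (1 + Complex.I) * (1 + Complex.I) = 2 * Complex.I := by
    linear_combination Complex.I_mul_I
  have hval : Complex.I ^ y * ((-Complex.I) ^ X.card * (1 + Complex.I) ^ Fintype.card ι) =
      (((-1) ^ X.card * (-1) ^ r * 2 ^ m : ℝ) : ℂ) := by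
    rw [hm, pow_add, ← mul_pow, hsq, neg_pow, mul_pow]
    calc _ = (-1) ^ X.card * Complex.I ^ (y + X.card + m) * 2 ^ m := by ring
      _ = _ := by
        rw [hr, pow_add, ← mul_pow, Complex.I_mul_I]
        push_cast
        rfl
  rw [hsum, hval, Complex.ofReal_re]
  simp [abs_mul]

/-- **Value of the per-source quantum correlator sum for even `L`.**
For even `L ≥ 2`, any `X ⊆ {1,…,L}`, with `R(L) = 1` if `L ≡ 0 (mod 4)` and `0`
otherwise, and Bob's setting `y_X = (1 + (-1)^{|X|+R(L)})/2`,
`|∑_{x ∈ {0,1}^L} (-1)^{∑_{k∈X} x_k} cos((π/2)(x₁+⋯+x_L + y_X))| = 2^{L/2}`,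
where `2^{L/2}` is the real number `(√2)^L`. -/
theorem quantum_correlator_even_L
    (L : ℕ) (hL : 2 ≤ L) (hLe : Even L) (X : Finset (Fin L)) :
    |∑ x : Fin L → Fin 2,
        (-1 : ℝ) ^ (∑ k ∈ X, (x k : ℕ)) *
          Real.cos (π / 2 *
            ((∑ k : Fin L, (x k : ℕ)) +
              (1 + (-1 : ℝ) ^ (X.card + if L % 4 = 0 then 1 else 0)) / 2))|
      = Real.sqrt 2 ^ L := by
  obtain ⟨m, hm⟩ := hLe
  have hsqrt : Real.sqrt 2 ^ L = 2 ^ m := by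
    rw [hm, pow_add, ← mul_pow, Real.mul_self_sqrt zero_le_two]
  have hmod : L % 4 = 0 ↔ Even m := by
    rw [Nat.even_iff]
    omega
  obtain ⟨y, hy, hEven⟩ : ∃ y : ℕ,
      (1 + (-1 : ℝ) ^ (X.card + if L % 4 = 0 then 1 else 0)) / 2 = y ∧
        Even (y + X.card + m) := by
    rcases Nat.even_or_odd (X.card + if L % 4 = 0 then 1 else 0) with h | h
    · refine ⟨1, by simp [h.neg_one_pow], ?_⟩
      split_ifs at h <;> simp_all only [Nat.even_iff] <;> omega
    · refine ⟨0, by simp [h.neg_one_pow], ?_⟩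
      split_ifs at h <;> simp_all only [Nat.even_iff, Nat.odd_iff] <;> omega
  rw [hy, hsqrt, ← abs_sum_neg_one_pow_mul_cos X (by simpa using hm) hEven]
end

section
/- Fix integers n ≥ 1 and L_1,…,L_n ≥ 1, and set L = max{L_1,…,L_n}. For j = 1,…,n let (Λ_j, q_j) be a measurable space equipped with a probability measure, and suppose that for each j ∈ {1,…,n}, k ∈ {1,…,L_j} and each setting x ∈ {0,1} there is a measurable function A_{j,k}^{x} : Λ_j → [−1,1], and for each subset X ⊆ {1,…,L} there is a measurable function B_X : Λ_1 × ⋯ × Λ_n → [−1,1]. For each X ⊆ {1,…,L} define Q_X = 2^{−∑_{j=1}^{n} L_j} ∑_{x̄} [∏_{j=1}^{n} (−1)^{∑_{k ∈ X_j} x_j^k}] ∫ (∏_{j=1}^{n} ∏_{k=1}^{L_j} A_{j,k}^{x_j^k}(λ_j)) · B_X(λ_1,…,λ_n) dq_1(λ_1)⋯dq_n(λ_n), where X_j = {s ∈ X : s ≤ L_j} and the sum runs over all tuples x̄ = (x_j^k)_{j ≤ n, k ≤ L_j} of binary settings. Then ∑_{X ⊆ {1,…,L}} |Q_X|^{1/n}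 ≤ 2^{L} · 2^{−(1/n) ∑_{j=1}^{n} L_j}. -/
open MeasureTheory

theorem sum_prod_ite_castLE_mem {l L : ℕ} (h : l ≤ L) (u v : Fin l → ℝ) :
    ∑ X : Finset (Fin L), ∏ k : Fin l, (if Fin.castLE h k ∈ X then u k else v k) =
      2 ^ (L - l) * ∏ k, (u k + v k) := by
  obtain ⟨m, rfl⟩ := Nat.exists_eq_add_of_le h
  have key := Fintype.prod_add (Fin.append u fun _ : Fin m => (1 : ℝ))
    (Fin.append v fun _ : Fin m => (1 : ℝ))
  rw [Fin.prod_univ_add] at key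
  simp only [Fin.append_left, Fin.append_right, Finset.prod_const, Finset.card_univ,
    Fintype.card_fin, one_add_one_eq_two] at key
  rw [Nat.add_sub_cancel_left, mul_comm, key]
  refine Finset.sum_congr rfl fun X _ => ?_
  have hX := Finset.prod_ite (s := Finset.univ) (p := fun i => i ∈ X)
    (Fin.append u fun _ : Fin m => (1 : ℝ)) (Fin.append v fun _ : Fin m => (1 : ℝ))
  rw [Fin.prod_univ_add] at hX
  simp only [Fin.append_left, Fin.append_right, ite_self, Finset.prod_const_one, mul_one] at hX
  refine Eq.trans hX ?_
  congr 2 <;> ext <;> simp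

/-- A form of Hölder's inequality for `n` functions with equal exponents. -/
theorem sum_prod_rpow_le {ι κ : Type*} [Fintype ι] [Nonempty ι] [Fintype κ]
    (a : ι → κ → ℝ) (M : ι → ℝ) (ha : ∀ j X, 0 ≤ a j X) (hM : ∀ j, 0 < M j)
    (hsum : ∀ j, ∑ X, a j X ≤ M j) :
    ∑ X, (∏ j, a j X) ^ ((1 : ℝ) / Fintype.card ι) ≤
      (∏ j, M j) ^ ((1 : ℝ) / Fintype.card ι) := by
  set w : ℝ := 1 / Fintype.card ι with hw
  have hw0 : 0 ≤ w := by positivity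
  have hw1 : ∑ _j : ι, w = 1 := by simp [hw]
  have hX (X : κ) : (∏ j, a j X) ^ w ≤ (∏ j, M j) ^ w * ∑ j, w * (a j X / M j) := by
    have h := Real.geom_mean_le_arith_mean_weighted Finset.univ (fun _ : ι => w)
      (fun j => a j X / M j) (fun _ _ => hw0) hw1
      fun j _ => div_nonneg (ha j X) (hM j).le
    rw [Real.finsetProd_rpow _ _ fun j _ => div_nonneg (ha j X) (hM j).le,
      Finset.prod_div_distrib, Real.div_rpow (Finset.prod_nonneg fun j _ => ha j X)
        (Finset.prod_nonneg fun j _ => (hM j).le),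
      div_le_iff₀ (Real.rpow_pos_of_pos (Finset.prod_pos fun j _ => hM j) _)] at h
    rwa [mul_comm]
  calc ∑ X, (∏ j, a j X) ^ w
      ≤ ∑ X, (∏ j, M j) ^ w * ∑ j, w * (a j X / M j) := Finset.sum_le_sum fun X _ => hX X
    _ = (∏ j, M j) ^ w * ∑ j, w * ((∑ X, a j X) / M j) := by
        rw [← Finset.mul_sum, Finset.sum_comm]
        simp only [Finset.mul_sum, Finset.sum_div]
    _ ≤ (∏ j, M j) ^ w * ∑ _j : ι, w * 1 := by
        have := Real.rpow_nonneg (Finset.prod_nonneg fun j (_ : j ∈ Finset.univ) => (hM j).le) w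
        gcongr with j
        exact div_le_one_of_le₀ (hsum j) (hM j).le
    _ = (∏ j, M j) ^ w := by simp only [mul_one, hw1]

theorem abs_half_add_add_abs_half_sub_le_one {a b : ℝ} (ha : a ∈ Set.Icc (-1 : ℝ) 1)
    (hb : b ∈ Set.Icc (-1 : ℝ) 1) : |(a - b) / 2| + |(a + b) / 2| ≤ 1 := by
  obtain ⟨_, _⟩ := ha
  obtain ⟨_, _⟩ := hb
  rcases abs_cases ((a - b) / 2) with h | h <;> rcases abs_cases ((a + b) / 2) with h' | h' <;>
    linarith

/-- The signed average over all settings of a product of local responses factorizes. -/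
theorem inv_two_pow_mul_sum_signed_prod {n : ℕ} {Lf : Fin n → ℕ}
    (s : (j : Fin n) → Fin (Lf j) → Prop) [∀ j k, Decidable (s j k)]
    (g : (j : Fin n) → Fin (Lf j) → Fin 2 → ℝ) :
    (2 : ℝ)⁻¹ ^ (∑ j : Fin n, Lf j) *
      ∑ x : (j : Fin n) → Fin (Lf j) → Fin 2,
        (∏ j, (-1 : ℝ) ^ (∑ k, if s j k then (x j k : ℕ) else 0)) *
          ∏ j, ∏ k, g j k (x j k) =
    ∏ j, ∏ k, (if s j k then (g j k 0 - g j k 1) / 2 else (g j k 0 + g j k 1) / 2) := by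
  have h1 (j : Fin n) (k : Fin (Lf j)) :
      (if s j k then (g j k 0 - g j k 1) / 2 else (g j k 0 + g j k 1) / 2) =
        2⁻¹ * ∑ b : Fin 2, (-1 : ℝ) ^ (if s j k then (b : ℕ) else 0) * g j k b := by
    rw [Fin.sum_univ_two]
    split_ifs <;> simp <;> ring
  simp only [h1, Finset.prod_mul_distrib, Finset.prod_const, Finset.card_univ, Fintype.card_fin,
    Finset.prod_pow_eq_pow_sum, Finset.prod_univ_sum, Fintype.piFinset_univ]

/-- **Bell-type inequality for the generalized network `𝒩_n^{L₁…L_n}` (equation (45)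
of the paper).**  The `j`-th independent source distributes a hidden variable
`λ_j ∼ μ j` to `L_j` observers (local outcome expectations `A j k x λ_j ∈ [-1,1]`)
and to the central observer Bob (outcome expectation `B X λ̄ ∈ [-1,1]` for the setting
associated to `X ⊆ {1,…,L}` with `L = max_j L_j`).  With `X_j = {s ∈ X : s ≤ L_j}` and
`Q X = 2^{-∑_j L_j} ∑_{x̄} (∏_j (-1)^{∑_{k∈X_j} x_j^k})
        ∫ (∏_j ∏_{k=1}^{L_j} A j k (x_j^k) λ_j) B X λ̄ dμ`,
every classical model satisfies
`∑_{X ⊆ {1,…,L}} |Q X|^{1/n} ≤ 2^L · 2^{-(1/n) ∑_j L_j}`. -/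
theorem bell_inequality_generalized_network
    (n : ℕ) (hn : 1 ≤ n) (Lf : Fin n → ℕ) (hLf : ∀ j, 1 ≤ Lf j)
    (L : ℕ) (hle : ∀ j, Lf j ≤ L) (hmax : ∃ j, Lf j = L)
    (Λ : Fin n → Type) [∀ j, MeasurableSpace (Λ j)]
    (μ : ∀ j, Measure (Λ j)) [∀ j, IsProbabilityMeasure (μ j)]
    (A : (j : Fin n) → Fin (Lf j) → Fin 2 → Λ j → ℝ)
    (hAmeas : ∀ j k x, Measurable (A j k x))
    (hAbd : ∀ j k x lam, A j k x lam ∈ Set.Icc (-1 : ℝ) 1)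
    (B : Finset (Fin L) → (∀ j, Λ j) → ℝ)
    (hBmeas : ∀ X, Measurable (B X))
    (hBbd : ∀ X lam, B X lam ∈ Set.Icc (-1 : ℝ) 1)
    (Q : Finset (Fin L) → ℝ)
    (hQ : ∀ X : Finset (Fin L), Q X =
      (2 : ℝ)⁻¹ ^ (∑ j : Fin n, Lf j) *
        ∑ x : (j : Fin n) → Fin (Lf j) → Fin 2,
          (∏ j : Fin n,
              (-1 : ℝ) ^ (∑ k : Fin (Lf j),
                if Fin.castLE (hle j) k ∈ X then (x j k : ℕ) else 0)) *
            ∫ lam, (∏ j : Fin n, ∏ k : Fin (Lf j), A j k (x j k) (lam j)) * B X lam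
              ∂(Measure.pi μ)) :
    ∑ X : Finset (Fin L), |Q X| ^ ((1 : ℝ) / n)
      ≤ 2 ^ (L : ℝ) * 2 ^ (-(1 / n : ℝ) * ∑ j : Fin n, (Lf j : ℝ)) := by
  have : Nonempty (Fin n) := ⟨⟨0, hn⟩⟩
  let F (X : Finset (Fin L)) (j : Fin n) (l : Λ j) : ℝ :=
    ∏ k : Fin (Lf j), if Fin.castLE (hle j) k ∈ X then (A j k 0 l - A j k 1 l) / 2
      else (A j k 0 l + A j k 1 l) / 2
  have hFmeas (X j) : Measurable (F X j) := by
    refine Finset.measurable_fun_prod _ fun k _ => ?_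
    have h0 := hAmeas j k 0
    have h1 := hAmeas j k 1
    split_ifs <;> fun_prop
  have habs (X j l) : |F X j l| = ∏ k : Fin (Lf j),
      if Fin.castLE (hle j) k ∈ X then |(A j k 0 l - A j k 1 l) / 2|
        else |(A j k 0 l + A j k 1 l) / 2| := by
    simp only [F, Finset.abs_prod, apply_ite abs]
  have hFle (X j l) : |F X j l| ≤ 1 := by
    rw [habs]
    refine Finset.prod_le_one (fun k _ => by split_ifs <;> positivity) fun k _ => ?_
    have h := abs_half_add_add_abs_half_sub_le_one (hAbd j k 0 l) (hAbd j k 1 l)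
    have := abs_nonneg ((A j k 0 l - A j k 1 l) / 2)
    have := abs_nonneg ((A j k 0 l + A j k 1 l) / 2)
    split_ifs <;> linarith
  have hFint (X j) : Integrable (fun l => |F X j l|) (μ j) :=
    Integrable.of_bound (hFmeas X j).abs.aestronglyMeasurable 1
      (ae_of_all _ fun l => by simpa using hFle X j l)
  have hFsum (j) (l : Λ j) : ∑ X, |F X j l| ≤ 2 ^ (L - Lf j) := by
    simp only [habs]
    rw [sum_prod_ite_castLE_mem]
    exact mul_le_of_le_one_right (by positivity) (Finset.prod_le_one (fun k _ => by positivity)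
      fun k _ => abs_half_add_add_abs_half_sub_le_one (hAbd j k 0 l) (hAbd j k 1 l))
  have hcsum (j) : ∑ X, ∫ l, |F X j l| ∂μ j ≤ 2 ^ (L - Lf j) := by
    rw [← integral_finsetSum _ fun X _ => hFint X j]
    calc ∫ l, ∑ X, |F X j l| ∂μ j ≤ ∫ _, (2 : ℝ) ^ (L - Lf j) ∂μ j :=
          integral_mono (integrable_finsetSum _ fun X _ => hFint X j) (integrable_const _)
            (hFsum j)
      _ = 2 ^ (L - Lf j) := by simp
  have hABint (X) (x : (j : Fin n) → Fin (Lf j) → Fin 2) : Integrable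
      (fun lam => (∏ j, ∏ k, A j k (x j k) (lam j)) * B X lam) (Measure.pi μ) := by
    have hB := hBmeas X
    refine Integrable.of_bound (C := 1) (Measurable.aestronglyMeasurable ?_)
      (ae_of_all _ fun lam => ?_)
    · exact (Finset.measurable_fun_prod _ fun j _ => Finset.measurable_fun_prod _ fun k _ =>
        (hAmeas j k _).comp (measurable_pi_apply j)).mul hB
    · rw [Real.norm_eq_abs, abs_mul, Finset.abs_prod]
      refine mul_le_one₀ (Finset.prod_le_one (fun j _ => abs_nonneg _) fun j _ => ?_)
        (abs_nonneg _) (abs_le.2 (hBbd X lam))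
      rw [Finset.abs_prod]
      exact Finset.prod_le_one (fun k _ => abs_nonneg _) fun k _ => abs_le.2 (hAbd j k _ _)
  have hQF (X) : Q X = ∫ lam, (∏ j, F X j (lam j)) * B X lam ∂Measure.pi μ := by
    rw [hQ]
    simp only [← integral_const_mul]
    rw [← integral_finsetSum _ fun x _ => (hABint X x).const_mul _, ← integral_const_mul]
    congr 1 with lam
    rw [← inv_two_pow_mul_sum_signed_prod (fun j k => Fin.castLE (hle j) k ∈ X)
      fun j k b => A j k b (lam j)]
    simp only [Finset.mul_sum, Finset.sum_mul, mul_assoc]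
  have hQle (X) : |Q X| ≤ ∏ j, ∫ l, |F X j l| ∂μ j := by
    rw [hQF, ← integral_fintype_prod_eq_prod, ← Real.norm_eq_abs]
    have hint : Integrable (fun lam : ∀ j, Λ j => ∏ j, |F X j (lam j)|) (Measure.pi μ) :=
      Integrable.fintype_prod_dep (f := fun j l => |F X j l|) fun j => hFint X j
    refine norm_integral_le_of_norm_le hint (ae_of_all _ fun lam => ?_)
    rw [Real.norm_eq_abs, abs_mul, Finset.abs_prod]
    exact mul_le_of_le_one_right (Finset.prod_nonneg fun j _ => abs_nonneg _)
      (abs_le.2 (hBbd X lam))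
  have hn0 : (n : ℝ) ≠ 0 := by positivity
  calc ∑ X, |Q X| ^ ((1 : ℝ) / n)
      ≤ ∑ X, (∏ j, ∫ l, |F X j l| ∂μ j) ^ ((1 : ℝ) / n) := by
        gcongr with X
        exact hQle X
    _ ≤ (∏ j, (2 : ℝ) ^ (L - Lf j)) ^ ((1 : ℝ) / n) := by
        simpa using sum_prod_rpow_le (fun j X => ∫ l, |F X j l| ∂μ j)
          (fun j => (2 : ℝ) ^ (L - Lf j)) (fun j X => integral_nonneg fun l => abs_nonneg _)
          (fun j => by positivity) hcsum
    _ = 2 ^ (L : ℝ) * 2 ^ (-(1 / n : ℝ) * ∑ j : Fin n, (Lf j : ℝ)) := by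
        rw [Finset.prod_pow_eq_pow_sum, ← Real.rpow_natCast, ← Real.rpow_mul zero_le_two,
          ← Real.rpow_add zero_lt_two]
        congr 1
        push_cast [hle]
        rw [Finset.sum_sub_distrib]
        simp only [Finset.sum_const, Finset.card_univ, Fintype.card_fin, nsmul_eq_mul]
        field_simp
        ring
end
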